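/- arXiv:2404.06789 — 4 statements merged into one kernel-verified Lean document; each statement's English description precedes it below -/
import Mathlib

section
/- Let H > 0, r_s ∈ (0, 1/2), c_1 ≠ 0, c_2 > 0 and T ∈ ℝ. Then there exists a unique function ρ : [T, ∞) → (0, ∞) such that, setting v_1(t) = c_1 e^{−Ht} and v_0(t) = sqrt(v_1(t)^2 + ρ(t)^{2 r_s}), the identity ρ(t)^{1−2 r_s} e^{3Ht} v_0(t) = c_2 holds for all t ≥ T. For this triple (ρ, v_0, v_1), the quantities e^{Ht} v_1(t) and ρ(t)^{1−2 r_s} e^{3Ht} v_0(t) are constant in t, i.e. the homogeneous relativistic Euler equations d/dt(a v_1) = 0 and d/dt(ρ^{1−2 r_s} a^3 v_0) = 0 on the de Sitter FLRW background with scale factor a(t) = e^{Ht} are satisfied. -/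
open Real

/-- The charge `x ^ p * k * √(b ^ 2 + x ^ q)` is strictly increasing in the density `x ≥ 0`. -/
theorem charge_strictMonoOn {p q k : ℝ} (b : ℝ) (hp : 0 < p) (hq : 0 < q) (hk : 0 < k) :
    StrictMonoOn (fun x : ℝ => x ^ p * k * Real.sqrt (b ^ 2 + x ^ q)) (Set.Ici 0) := by
  intro x hx y _ hxy
  have hx : 0 ≤ x := hx
  have hpow : x ^ p < y ^ p := Real.rpow_lt_rpow hx hxy hp
  have hpow' : x ^ q < y ^ q := Real.rpow_lt_rpow hx hxy hq
  have hxp : 0 ≤ x ^ p := Real.rpow_nonneg hx p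
  have hxq : 0 ≤ x ^ q := Real.rpow_nonneg hx q
  have hsqrt : Real.sqrt (b ^ 2 + x ^ q) < Real.sqrt (b ^ 2 + y ^ q) :=
    Real.sqrt_lt_sqrt (by positivity) (by linarith)
  exact mul_lt_mul'' (by gcongr) hsqrt (by positivity) (Real.sqrt_nonneg _)

theorem charge_tendsto_atTop {p q k : ℝ} (b : ℝ) (hp : 0 < p) (hq : 0 < q) (hk : 0 < k) :
    Filter.Tendsto (fun x : ℝ => x ^ p * k * Real.sqrt (b ^ 2 + x ^ q))
      Filter.atTop Filter.atTop :=
  ((tendsto_rpow_atTop hp).atTop_mul_const hk).atTop_mul_atTop₀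
    (Real.tendsto_sqrt_atTop.comp
      (Filter.tendsto_atTop_add_const_left _ _ (tendsto_rpow_atTop hq)))

theorem existsUnique_pos_charge_eq {p q k c : ℝ} (b : ℝ) (hp : 0 < p) (hq : 0 < q)
    (hk : 0 < k) (hc : 0 < c) :
    ∃! x : ℝ, 0 < x ∧ x ^ p * k * Real.sqrt (b ^ 2 + x ^ q) = c := by
  obtain ⟨M, hM, hM0⟩ := (((charge_tendsto_atTop b hp hq hk).eventually_ge_atTop c).and
    (Filter.eventually_ge_atTop 0)).exists
  have hcont : Continuous fun x : ℝ => x ^ p * k * Real.sqrt (b ^ 2 + x ^ q) :=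
    ((Real.continuous_rpow_const hp.le).mul continuous_const).mul
      (continuous_const.add (Real.continuous_rpow_const hq.le)).sqrt
  obtain ⟨x, hx, hxc⟩ := intermediate_value_Icc hM0 hcont.continuousOn
    ⟨by simpa [Real.zero_rpow hp.ne'] using hc.le, hM⟩
  have hx0 : x ≠ 0 := by
    rintro rfl
    simp only [Real.zero_rpow hp.ne', zero_mul] at hxc
    exact hc.ne hxc
  refine ⟨x, ⟨lt_of_le_of_ne hx.1 hx0.symm, hxc⟩, fun y hy => ?_⟩
  exact (charge_strictMonoOn b hp hq hk).injOn hy.1.le hx.1 (hy.2.trans hxc.symm)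

/-- Existence and uniqueness of the homogeneous tilted fluid density on the de Sitter
FLRW background: there is a unique positive `ρ` on `[T,∞)` with
`ρ^{1−2r_s} e^{3Ht} v₀ = c₂`, where `v₁(t) = c₁ e^{−Ht}` and
`v₀ = sqrt(v₁² + ρ^{2r_s})`; moreover for this solution both `e^{Ht} v₁(t)` and
`ρ^{1−2r_s} e^{3Ht} v₀(t)` are constant in `t` (the homogeneous relativistic Euler
equations hold). -/
theorem homogeneous_tilted_fluid_existence_uniqueness
    (H rs c₁ c₂ T : ℝ) (hH : 0 < H) (hrs0 : 0 < rs) (hrs1 : rs < 1 / 2)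
    (hc₁ : c₁ ≠ 0) (hc₂ : 0 < c₂) :
    ∃ ρ : ℝ → ℝ,
      ((∀ t, T ≤ t → 0 < ρ t) ∧
        (∀ t, T ≤ t →
          ρ t ^ (1 - 2 * rs) * exp (3 * H * t) *
            Real.sqrt ((c₁ * exp (-(H * t))) ^ 2 + ρ t ^ (2 * rs)) = c₂)) ∧
      (∀ ρ' : ℝ → ℝ,
        (∀ t, T ≤ t → 0 < ρ' t) →
        (∀ t, T ≤ t →
          ρ' t ^ (1 - 2 * rs) * exp (3 * H * t) *
            Real.sqrt ((c₁ * exp (-(H * t))) ^ 2 + ρ' t ^ (2 * rs)) = c₂) →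
        ∀ t, T ≤ t → ρ' t = ρ t) ∧
      (∀ t, T ≤ t → exp (H * t) * (c₁ * exp (-(H * t))) = c₁) ∧
      (∀ t, T ≤ t →
        ρ t ^ (1 - 2 * rs) * exp (3 * H * t) *
          Real.sqrt ((c₁ * exp (-(H * t))) ^ 2 + ρ t ^ (2 * rs)) = c₂) := by
  choose ρ hρ huniq using fun t : ℝ =>
    existsUnique_pos_charge_eq (p := 1 - 2 * rs) (q := 2 * rs) (c₁ * exp (-(H * t)))
      (by linarith) (by linarith) (exp_pos (3 * H * t)) hc₂
  refine ⟨ρ, ⟨fun t _ => (hρ t).1, fun t _ => (hρ t).2⟩,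
    fun ρ' hpos heq t ht => huniq t (ρ' t) ⟨hpos t ht, heq t ht⟩, fun t _ => ?_,
    fun t _ => (hρ t).2⟩
  rw [mul_left_comm, ← exp_add, add_neg_cancel, exp_zero, mul_one]
end

section
/- Let H > 0, r_s ∈ (0, 1/2), c_1 ≠ 0, c_2 > 0 and T ∈ ℝ, and let ρ : [T, ∞) → (0, ∞) satisfy ρ(t)^{1−2 r_s} e^{3Ht} v_0(t) = c_2 for all t ≥ T, where v_1(t) = c_1 e^{−Ht} and v_0(t) = sqrt(v_1(t)^2 + ρ(t)^{2 r_s}). Then ρ(t) ≤ (c_2 e^{−3Ht})^{1/(1−r_s)} for all t ≥ T, and consequently ρ(t)^{2 r_s} ≤ c_2^{2 r_s/(1−r_s)} e^{−(6 r_s/(1−r_s)) H t}; if moreover r_s > 1/4 then 6 r_s/(1−r_s) > 2 and hence e^{2Ht} ρ(t)^{2 r_s} → 0 as t → ∞. -/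
open Real Filter

/-- A conservation law `x ^ (1 - 2 * r) * E * sqrt (a ^ 2 + x ^ (2 * r)) = c` bounds `x` by
its value in the untilted case `a = 0`. -/
theorem le_rpow_of_conservation {r a E c x : ℝ} (hr : r < 1) (hE : 0 < E) (hx : 0 < x)
    (h : x ^ (1 - 2 * r) * E * Real.sqrt (a ^ 2 + x ^ (2 * r)) = c) :
    x ≤ (c * E⁻¹) ^ (1 / (1 - r)) := by
  have hr' : 0 < 1 - r := by linarith
  have hsqrt : x ^ r ≤ Real.sqrt (a ^ 2 + x ^ (2 * r)) := by
    apply Real.le_sqrt_of_sq_le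
    rw [← Real.rpow_mul_natCast hx.le, Nat.cast_ofNat, mul_comm r 2]
    exact le_add_of_nonneg_left (sq_nonneg a)
  have hpow : x ^ (1 - r) ≤ c * E⁻¹ := by
    rw [le_mul_inv_iff₀ hE, ← h]
    calc x ^ (1 - r) * E = x ^ (1 - 2 * r) * E * x ^ r := by
          rw [mul_right_comm, ← Real.rpow_add hx]; ring_nf
      _ ≤ _ := by gcongr
  calc x = (x ^ (1 - r)) ^ (1 / (1 - r)) := by
        rw [← Real.rpow_mul hx.le, mul_one_div_cancel hr'.ne', Real.rpow_one]
    _ ≤ _ := by gcongr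

/-- Decay of the homogeneous density: if `ρ^{1−2r_s} e^{3Ht} v₀ = c₂` with
`v₀ = sqrt(v₁² + ρ^{2r_s})`, `v₁ = c₁ e^{−Ht}`, then
`ρ(t) ≤ (c₂ e^{−3Ht})^{1/(1−r_s)}`, hence
`ρ(t)^{2r_s} ≤ c₂^{2r_s/(1−r_s)} e^{−(6r_s/(1−r_s))Ht}`; and if `r_s > 1/4` then
`6r_s/(1−r_s) > 2` and `e^{2Ht} ρ(t)^{2r_s} → 0`. -/
theorem homogeneous_density_decay
    (H rs c₁ c₂ T : ℝ) (hH : 0 < H) (hrs0 : 0 < rs) (hrs1 : rs < 1 / 2)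
    (hc₁ : c₁ ≠ 0) (hc₂ : 0 < c₂)
    (ρ : ℝ → ℝ) (hρpos : ∀ t, T ≤ t → 0 < ρ t)
    (hcons : ∀ t, T ≤ t →
      ρ t ^ (1 - 2 * rs) * exp (3 * H * t) *
        Real.sqrt ((c₁ * exp (-(H * t))) ^ 2 + ρ t ^ (2 * rs)) = c₂) :
    (∀ t, T ≤ t → ρ t ≤ (c₂ * exp (-(3 * H * t))) ^ (1 / (1 - rs))) ∧
    (∀ t, T ≤ t →
      ρ t ^ (2 * rs) ≤ c₂ ^ (2 * rs / (1 - rs)) * exp (-(6 * rs / (1 - rs)) * H * t)) ∧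
    (1 / 4 < rs →
      2 < 6 * rs / (1 - rs) ∧
      Tendsto (fun t => exp (2 * H * t) * ρ t ^ (2 * rs)) atTop (nhds 0)) := by
  have hr : 0 < 1 - rs := by linarith
  have hρ : ∀ t, T ≤ t → ρ t ≤ (c₂ * exp (-(3 * H * t))) ^ (1 / (1 - rs)) := fun t ht => by
    rw [exp_neg]
    exact le_rpow_of_conservation (by linarith) (exp_pos _) (hρpos t ht) (hcons t ht)
  have hρ' : ∀ t, T ≤ t →
      ρ t ^ (2 * rs) ≤ c₂ ^ (2 * rs / (1 - rs)) * exp (-(6 * rs / (1 - rs)) * H * t) :=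
    fun t ht => by
      calc ρ t ^ (2 * rs)
          ≤ ((c₂ * exp (-(3 * H * t))) ^ (1 / (1 - rs))) ^ (2 * rs) :=
            Real.rpow_le_rpow (hρpos t ht).le (hρ t ht) (by positivity)
        _ = c₂ ^ (2 * rs / (1 - rs)) * exp (-(6 * rs / (1 - rs)) * H * t) := by
            rw [← Real.rpow_mul (by positivity), one_div_mul_eq_div,
              Real.mul_rpow hc₂.le (exp_pos _).le, ← Real.exp_mul]
            ring_nf
  refine ⟨hρ, hρ', fun hrs => ?_⟩
  have hexp : 2 < 6 * rs / (1 - rs) := by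
    rw [lt_div_iff₀ hr]
    linarith
  refine ⟨hexp, ?_⟩
  have hrate : (2 - 6 * rs / (1 - rs)) * H < 0 := mul_neg_of_neg_of_pos (by linarith) hH
  have hlim : Tendsto
      (fun t => c₂ ^ (2 * rs / (1 - rs)) * exp ((2 - 6 * rs / (1 - rs)) * H * t))
      atTop (nhds 0) := by
    simpa using (tendsto_exp_atBot.comp
      (tendsto_id.const_mul_atTop_of_neg hrate)).const_mul (c₂ ^ (2 * rs / (1 - rs)))
  refine squeeze_zero' ?_ ?_ hlim
  · filter_upwards [eventually_ge_atTop T] with t ht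
    have := hρpos t ht
    positivity
  · filter_upwards [eventually_ge_atTop T] with t ht
    calc exp (2 * H * t) * ρ t ^ (2 * rs)
        ≤ exp (2 * H * t) *
            (c₂ ^ (2 * rs / (1 - rs)) * exp (-(6 * rs / (1 - rs)) * H * t)) := by
          gcongr
          exact hρ' t ht
      _ = c₂ ^ (2 * rs / (1 - rs)) * exp ((2 - 6 * rs / (1 - rs)) * H * t) := by
          rw [mul_left_comm, ← Real.exp_add]
          ring_nf
end

section
/- Let H > 0, r_s ∈ (1/4, 1/2), c_1 ≠ 0, c_2 > 0 and T ∈ ℝ, and let ρ : [T, ∞) → (0, ∞) satisfy ρ(t)^{1−2 r_s} e^{3Ht} v_0(t) = c_2 for all t ≥ T, where v_1(t) = c_1 e^{−Ht} and v_0(t) = sqrt(v_1(t)^2 + ρ(t)^{2 r_s}). Then as t → ∞: e^{Ht} v_0(t) → |c_1| and e^{(2/(1−2 r_s)) H t} ρ(t) → (c_2/|c_1|)^{1/(1−2 r_s)}. -/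
open Real Filter

/-- Leading asymptotics of the homogeneous tilted fluid beyond radiation
(`r_s ∈ (1/4, 1/2)`): `e^{Ht} v₀(t) → |c₁|` and
`e^{(2/(1−2r_s))Ht} ρ(t) → (c₂/|c₁|)^{1/(1−2r_s)}`. -/
theorem homogeneous_fluid_asymptotics
    (H rs c₁ c₂ T : ℝ) (hH : 0 < H) (hrs0 : 1 / 4 < rs) (hrs1 : rs < 1 / 2)
    (hc₁ : c₁ ≠ 0) (hc₂ : 0 < c₂)
    (ρ : ℝ → ℝ) (hρpos : ∀ t, T ≤ t → 0 < ρ t)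
    (hcons : ∀ t, T ≤ t →
      ρ t ^ (1 - 2 * rs) * exp (3 * H * t) *
        Real.sqrt ((c₁ * exp (-(H * t))) ^ 2 + ρ t ^ (2 * rs)) = c₂) :
    Tendsto (fun t => exp (H * t) *
        Real.sqrt ((c₁ * exp (-(H * t))) ^ 2 + ρ t ^ (2 * rs))) atTop (nhds |c₁|) ∧
    Tendsto (fun t => exp ((2 / (1 - 2 * rs)) * H * t) * ρ t) atTop
      (nhds ((c₂ / |c₁|) ^ (1 / (1 - 2 * rs)))) := by
  set p : ℝ := 1 - 2 * rs with hp_def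
  have hp : 0 < p := by rw [hp_def]; linarith
  have habs : 0 < |c₁| := abs_pos.mpr hc₁
  set V : ℝ → ℝ := fun t => exp (H * t) *
    Real.sqrt ((c₁ * exp (-(H * t))) ^ 2 + ρ t ^ (2 * rs)) with hV_def
  have hV : ∀ t, V t = Real.sqrt (c₁ ^ 2 + exp (2 * H * t) * ρ t ^ (2 * rs)) := by
    intro t
    have hsq : exp (2 * H * t) = exp (H * t) ^ 2 := by
      rw [sq, ← exp_add]; congr 1; ring
    have hinv : exp (H * t) * exp (-(H * t)) = 1 := by
      rw [← exp_add, add_neg_cancel, exp_zero]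
    have harg : c₁ ^ 2 + exp (2 * H * t) * ρ t ^ (2 * rs) =
        exp (H * t) ^ 2 * ((c₁ * exp (-(H * t))) ^ 2 + ρ t ^ (2 * rs)) := by
      rw [hsq]
      linear_combination
        (-c₁ ^ 2 * (exp (H * t) * exp (-(H * t)) + 1)) * hinv
    rw [harg, Real.sqrt_mul (sq_nonneg _), Real.sqrt_sq (exp_pos _).le]
  have hVge : ∀ t, T ≤ t → |c₁| ≤ V t := by
    intro t ht
    rw [hV, ← Real.sqrt_sq_eq_abs]
    have := rpow_nonneg (hρpos t ht).le (2 * rs)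
    exact Real.sqrt_le_sqrt (le_add_of_nonneg_right (by positivity))
  -- Raising the conservation law to the power `1 / p` solves it for the rescaled density.
  have hρ : ∀ t, T ≤ t →
      exp ((2 / p) * H * t) * ρ t = (c₂ / V t) ^ (1 / p) := by
    intro t ht
    have hVpos : 0 < V t := habs.trans_le (hVge t ht)
    have hρt := hρpos t ht
    have hlaw : c₂ / V t = exp (2 * H * t) * ρ t ^ p := by
      rw [div_eq_iff hVpos.ne', ← hcons t ht, hV_def]
      have hexp : exp (3 * H * t) = exp (2 * H * t) * exp (H * t) := by
        rw [← exp_add]; congr 1; ring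
      rw [hexp]; ring
    rw [hlaw, mul_rpow (exp_pos _).le (rpow_nonneg hρt.le _), ← exp_mul,
      ← rpow_mul hρt.le, mul_one_div_cancel hp.ne', rpow_one]
    congr 2; ring
  set K : ℝ := (c₂ / |c₁|) ^ (1 / p) with hK
  have hKnonneg : 0 ≤ K := by positivity
  have hρle : ∀ t, T ≤ t → ρ t ≤ K * exp (-((2 / p) * H * t)) := by
    intro t ht
    have hle : exp ((2 / p) * H * t) * ρ t ≤ K := by
      have hVpos : 0 < V t := habs.trans_le (hVge t ht)
      rw [hρ t ht, hK]
      exact rpow_le_rpow (by positivity)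
        (div_le_div_of_nonneg_left hc₂.le habs (hVge t ht)) (by positivity)
    rw [exp_neg, ← div_eq_mul_inv, le_div_iff₀ (exp_pos _), mul_comm]
    exact hle
  have hbound : ∀ t, T ≤ t → exp (2 * H * t) * ρ t ^ (2 * rs) ≤
      K ^ (2 * rs) * exp (-((8 * rs - 2) / p * H * t)) := by
    intro t ht
    calc exp (2 * H * t) * ρ t ^ (2 * rs)
        ≤ exp (2 * H * t) * (K * exp (-((2 / p) * H * t))) ^ (2 * rs) := by
          gcongr
          · exact (hρpos t ht).le
          · exact hρle t ht
      _ = K ^ (2 * rs) * exp (-((8 * rs - 2) / p * H * t)) := by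
          rw [mul_rpow hKnonneg (exp_pos _).le, ← exp_mul, mul_left_comm, ← exp_add]
          congr 2
          have hrs : rs = (1 - p) / 2 := by rw [hp_def]; ring
          rw [hrs]
          field_simp
          ring
  have hdecay : Tendsto (fun t => K ^ (2 * rs) * exp (-((8 * rs - 2) / p * H * t)))
      atTop (nhds 0) := by
    have hrate : 0 < (8 * rs - 2) / p * H := mul_pos (div_pos (by linarith) hp) hH
    simpa using ((tendsto_exp_neg_atTop_nhds_zero.comp
      (tendsto_id.const_mul_atTop hrate)).const_mul (K ^ (2 * rs)))
  have hsmall : Tendsto (fun t => exp (2 * H * t) * ρ t ^ (2 * rs)) atTop (nhds 0) := by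
    refine squeeze_zero' ?_ ?_ hdecay
    · filter_upwards [eventually_ge_atTop T] with t ht
      exact mul_nonneg (exp_pos _).le (rpow_nonneg (hρpos t ht).le _)
    · filter_upwards [eventually_ge_atTop T] with t ht using hbound t ht
  have hVlim : Tendsto V atTop (nhds |c₁|) := by
    have hlim := (hsmall.const_add (c₁ ^ 2)).sqrt
    rw [add_zero, Real.sqrt_sq_eq_abs] at hlim
    exact hlim.congr fun t => (hV t).symm
  refine ⟨hVlim, ?_⟩
  have hlim : Tendsto (fun t => (c₂ / V t) ^ (1 / p)) atTop (nhds K) :=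
    (tendsto_const_nhds.div hVlim habs.ne').rpow_const (Or.inr (by positivity))
  refine hlim.congr' ?_
  filter_upwards [eventually_ge_atTop T] with t ht using (hρ t ht).symm
end

section
/- Let H > 0, r_s ∈ (1/4, 1/2), c_1 ≠ 0, c_2 > 0 and T ∈ ℝ, set A_s = 2 r_s/(1 − 2 r_s) − 1 > 0, and let ρ : [T, ∞) → (0, ∞) satisfy ρ(t)^{1−2 r_s} e^{3Ht} v_0(t) = c_2 for all t ≥ T, where v_1(t) = c_1 e^{−Ht} and v_0(t) = sqrt(v_1(t)^2 + ρ(t)^{2 r_s}). Define the physical velocity components u_0 = ρ^{−r_s} v_0 and u_1 = ρ^{−r_s} v_1. Then u_0(t)^2 − u_1(t)^2 = 1 for all t, and as t → ∞: e^{−A_s H t} u_0(t) → L and e^{−A_s H t} u_1(t) → sgn(c_1) · L, where L = |c_1|^{(1−r_s)/(1−2 r_s)} · c_2^{−r_s/(1−2 r_s)} > 0. In particular the limits u_0^∞, u_1^∞ satisfy (u_0^∞)^2 = (u_1^∞)^2 ≠ 0, so the fluid exhibits extreme tilt: its unit velocity grows at the exact rate e^{A_s H t} and becomes asymptotically null.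 -/
open Real Filter

/-- The conservation law `ρ^{1−2r} e^{3s} v = c` in logarithmic form, in terms of `w = e^s v`. -/
lemma log_conservation {r c s ρ v : ℝ} (hρ : 0 < ρ) (hv : 0 < v)
    (h : ρ ^ (1 - 2 * r) * exp (3 * s) * v = c) :
    (1 - 2 * r) * log ρ + 2 * s + log (exp s * v) = log c := by
  rw [← h, log_mul (exp_pos s).ne' hv.ne', log_mul (by positivity) hv.ne',
    log_mul (by positivity) (exp_pos _).ne', log_rpow hρ, log_exp, log_exp]
  ring

/-- The conservation law solved for the power `ρ^{−r}` in terms of `w = e^s v`. -/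
lemma rpow_neg_eq_of_conservation {r c s ρ v : ℝ} (hr : r < 1 / 2) (hρ : 0 < ρ) (hv : 0 < v)
    (hc : 0 < c) (h : ρ ^ (1 - 2 * r) * exp (3 * s) * v = c) :
    ρ ^ (-r) = c ^ (-(r / (1 - 2 * r))) * (exp s * v) ^ (r / (1 - 2 * r)) *
      exp (2 * r / (1 - 2 * r) * s) := by
  have hk : 1 - 2 * r ≠ 0 := by linarith
  have hlog := log_conservation hρ hv h
  rw [rpow_def_of_pos hρ, rpow_def_of_pos hc, rpow_def_of_pos (by positivity), ← exp_add,
    ← exp_add, ← hlog]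
  congr 1
  linear_combination log ρ * div_mul_cancel₀ r hk

/-- If `w = e^s v` is bounded below by `a > 0`, the conservation law forces
`e^{2s} ρ^{2r}` to decay at the rate `e^{−2(2r/(1−2r) − 1)s}`. -/
lemma exp_mul_rpow_le_of_conservation {r a c s ρ v : ℝ} (hr0 : 0 < r) (hr : r < 1 / 2)
    (ha : 0 < a) (hρ : 0 < ρ) (hv : 0 < v) (hw : a ≤ exp s * v)
    (h : ρ ^ (1 - 2 * r) * exp (3 * s) * v = c) :
    exp (2 * s) * ρ ^ (2 * r) ≤
      exp (2 * r / (1 - 2 * r) * (log c - log a)) *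
        exp (-(2 * (2 * r / (1 - 2 * r) - 1) * s)) := by
  have hk : 0 < 1 - 2 * r := by linarith
  have hlog := log_conservation hρ hv h
  have hle : log a ≤ log (exp s * v) := log_le_log ha hw
  rw [rpow_def_of_pos hρ, ← exp_add, ← exp_add, exp_le_exp]
  have hmul : 2 * r / (1 - 2 * r) * ((1 - 2 * r) * log ρ) ≤
      2 * r / (1 - 2 * r) * (log c - log a - 2 * s) :=
    mul_le_mul_of_nonneg_left (by linarith) (by positivity)
  have hcancel : 2 * r / (1 - 2 * r) * ((1 - 2 * r) * log ρ) = 2 * r * log ρ := by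
    field_simp
  rw [hcancel] at hmul
  linarith

/-- Extreme tilt of the homogeneous fluid: with `A_s = 2r_s/(1−2r_s) − 1 > 0` and the
physical velocity `u_μ = ρ^{−r_s} v_μ`, one has `u₀² − u₁² = 1`, and
`e^{−A_s Ht} u₀(t) → L`, `e^{−A_s Ht} u₁(t) → sgn(c₁)·L`, where
`L = |c₁|^{(1−r_s)/(1−2r_s)} c₂^{−r_s/(1−2r_s)} > 0`; in particular the limits satisfy
`(u₀^∞)² = (u₁^∞)² ≠ 0`, so the unit velocity grows at the exact rate `e^{A_s Ht}` and
becomes asymptotically null. -/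
theorem homogeneous_fluid_extreme_tilt
    (H rs c₁ c₂ T As L : ℝ) (hH : 0 < H) (hrs0 : 1 / 4 < rs) (hrs1 : rs < 1 / 2)
    (hc₁ : c₁ ≠ 0) (hc₂ : 0 < c₂)
    (hAs : As = 2 * rs / (1 - 2 * rs) - 1)
    (hL : L = |c₁| ^ ((1 - rs) / (1 - 2 * rs)) * c₂ ^ (-(rs / (1 - 2 * rs))))
    (ρ v₀ v₁ u₀ u₁ : ℝ → ℝ) (hρpos : ∀ t, T ≤ t → 0 < ρ t)
    (hv₁ : ∀ t, v₁ t = c₁ * exp (-(H * t)))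
    (hv₀ : ∀ t, v₀ t = Real.sqrt (v₁ t ^ 2 + ρ t ^ (2 * rs)))
    (hu₀ : ∀ t, u₀ t = ρ t ^ (-rs) * v₀ t)
    (hu₁ : ∀ t, u₁ t = ρ t ^ (-rs) * v₁ t)
    (hcons : ∀ t, T ≤ t → ρ t ^ (1 - 2 * rs) * exp (3 * H * t) * v₀ t = c₂) :
    0 < As ∧ 0 < L ∧
    (∀ t, T ≤ t → u₀ t ^ 2 - u₁ t ^ 2 = 1) ∧
    Tendsto (fun t => exp (-(As * H * t)) * u₀ t) atTop (nhds L) ∧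
    Tendsto (fun t => exp (-(As * H * t)) * u₁ t) atTop (nhds (Real.sign c₁ * L)) ∧
    L ^ 2 = (Real.sign c₁ * L) ^ 2 ∧ (Real.sign c₁ * L) ^ 2 ≠ 0 := by
  have hk : 0 < 1 - 2 * rs := by linarith
  have hr : 0 < rs := by linarith
  have ha : 0 < |c₁| := abs_pos.mpr hc₁
  have hApos : 0 < As := by
    rw [hAs, sub_pos, lt_div_iff₀ hk]
    linarith
  have hLpos : 0 < L := by
    rw [hL]
    positivity
  have hsign : Real.sign c₁ * |c₁| = c₁ := by
    rcases hc₁.lt_or_gt with h | h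
    · rw [Real.sign_of_neg h, abs_of_neg h]
      ring
    · rw [Real.sign_of_pos h, abs_of_pos h, one_mul]
  have hsq : L ^ 2 = (Real.sign c₁ * L) ^ 2 := by
    rcases Real.sign_apply_eq_of_ne_zero c₁ hc₁ with h | h <;> rw [h] <;> ring
  have hv₀pos : ∀ t, T ≤ t → 0 < v₀ t := fun t ht => by
    have := hρpos t ht
    rw [hv₀]
    positivity
  have hcons' : ∀ t, T ≤ t → ρ t ^ (1 - 2 * rs) * exp (3 * (H * t)) * v₀ t = c₂ :=
    fun t ht => by rw [← mul_assoc 3 H t, hcons t ht]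
  have hw : ∀ t, exp (H * t) * v₀ t = √(c₁ ^ 2 + exp (2 * (H * t)) * ρ t ^ (2 * rs)) := by
    intro t
    rw [hv₀, hv₁]
    nth_rewrite 1 [← Real.sqrt_sq (exp_pos (H * t)).le]
    rw [← Real.sqrt_mul (sq_nonneg _)]
    congr 1
    rw [two_mul (H * t), exp_add, exp_neg]
    field_simp
  have hwge : ∀ t, T ≤ t → |c₁| ≤ exp (H * t) * v₀ t := fun t ht => by
    rw [hw, ← Real.sqrt_sq_eq_abs]
    have := hρpos t ht
    exact Real.sqrt_le_sqrt (le_add_of_nonneg_right (by positivity))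
  have hdecay : Tendsto (fun t => exp (2 * (H * t)) * ρ t ^ (2 * rs)) atTop (nhds 0) := by
    have hexp : Tendsto (fun t : ℝ => exp (-(2 * As * (H * t)))) atTop (nhds 0) :=
      tendsto_exp_neg_atTop_nhds_zero.comp
        ((tendsto_id.const_mul_atTop hH).const_mul_atTop (by positivity))
    have hbound := hexp.const_mul (exp (2 * rs / (1 - 2 * rs) * (log c₂ - log |c₁|)))
    rw [mul_zero] at hbound
    refine squeeze_zero' ?_ ?_ hbound
    · filter_upwards [eventually_ge_atTop T] with t ht
      have := hρpos t ht
      positivity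
    · filter_upwards [eventually_ge_atTop T] with t ht
      rw [hAs]
      exact exp_mul_rpow_le_of_conservation hr hrs1 ha (hρpos t ht) (hv₀pos t ht) (hwge t ht)
        (hcons' t ht)
  have hwlim : Tendsto (fun t => exp (H * t) * v₀ t) atTop (nhds |c₁|) := by
    simp only [hw]
    have := (hdecay.const_add (c₁ ^ 2)).sqrt
    rwa [add_zero, Real.sqrt_sq_eq_abs] at this
  have hscaled : ∀ t, T ≤ t → exp (-(As * H * t)) * ρ t ^ (-rs) =
      c₂ ^ (-(rs / (1 - 2 * rs))) * (exp (H * t) * v₀ t) ^ (rs / (1 - 2 * rs)) *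
        exp (H * t) := fun t ht => by
    have hexp : exp (-(As * H * t)) * exp (2 * rs / (1 - 2 * rs) * (H * t)) = exp (H * t) := by
      rw [← exp_add, hAs]
      congr 1
      ring
    rw [rpow_neg_eq_of_conservation hrs1 (hρpos t ht) (hv₀pos t ht) hc₂ (hcons' t ht), ← hexp]
    ring
  have hpow : Tendsto (fun t => c₂ ^ (-(rs / (1 - 2 * rs))) *
      (exp (H * t) * v₀ t) ^ (rs / (1 - 2 * rs))) atTop
      (nhds (c₂ ^ (-(rs / (1 - 2 * rs))) * |c₁| ^ (rs / (1 - 2 * rs)))) :=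
    (hwlim.rpow_const (Or.inl ha.ne')).const_mul _
  have hL' : L = c₂ ^ (-(rs / (1 - 2 * rs))) * |c₁| ^ (rs / (1 - 2 * rs)) * |c₁| := by
    have hexponent : (1 - rs) / (1 - 2 * rs) = rs / (1 - 2 * rs) + 1 := by
      rw [div_add_one hk.ne']
      ring
    rw [hL, hexponent, rpow_add_one ha.ne']
    ring
  refine ⟨hApos, hLpos, ?_, ?_, ?_, hsq, hsq ▸ (pow_pos hLpos 2).ne'⟩
  · intro t ht
    have hρ := hρpos t ht
    have hcancel : (ρ t ^ (-rs)) ^ 2 * ρ t ^ (2 * rs) = 1 := by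
      rw [← rpow_mul_natCast hρ.le, ← rpow_add hρ]
      norm_num
      ring_nf
      exact rpow_zero _
    rw [hu₀, hu₁, mul_pow, mul_pow, hv₀, Real.sq_sqrt (by positivity)]
    linear_combination hcancel
  · rw [hL']
    refine (hpow.mul hwlim).congr' ?_
    filter_upwards [eventually_ge_atTop T] with t ht
    rw [hu₀, ← mul_assoc (exp (-(As * H * t))), hscaled t ht]
    ring
  · have hlim : Real.sign c₁ * L =
        c₂ ^ (-(rs / (1 - 2 * rs))) * |c₁| ^ (rs / (1 - 2 * rs)) * c₁ := by
      rw [hL', mul_left_comm, hsign]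
    rw [hlim]
    refine (hpow.mul_const c₁).congr' ?_
    filter_upwards [eventually_ge_atTop T] with t ht
    rw [hu₁, ← mul_assoc (exp (-(As * H * t))), hscaled t ht, hv₁, exp_neg]
    field_simp
end
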